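/- arXiv:1809.01016 — 3 statements merged into one kernel-verified Lean document; each statement's English description precedes it below -/
import Mathlib

section
/- Let f₁, …, f_T be generator functions with values in ℝ^{3×3}, one of which, f_{t*}, is the Gabor filter generator function f_{t*}(θ,σ,γ,λ,ψ) = (g_{θ,σ,γ,λ,ψ}(x,y))_{x,y∈{−1,0,1}}. Then there exists n* ∈ ℕ such that: for any od ∈ ℕ and any assignment t : {1, …, od} → {1, …, T} of a generator function f_{t_j} to each of od first-layer kernels, if at least n* indices j satisfy t_j = t*, then there exists a choice of parameter vectors p¹, …, p^{od} (with kⱼ = f_{t_j}(pʲ)) such that for every I ∈ ℝ^{3×3} indexed by {−1,0,1}², (Σ_{x,y} I_{x,y}·(kⱼ)_{x,y} = 0 for all j = 1, …, od) implies I = 0; consequently the corresponding GO-CNN is well-defined. (Corollary 3) -/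
/-- The Gabor filter function `g_{θ,σ,γ,λ,ψ}(x, y)`. -/
noncomputable def gabor (θ σ γ lam ψ : ℝ) (x y : ℝ) : ℝ :=
  let x' : ℝ := x * Real.cos θ + y * Real.sin θ
  let y' : ℝ := -x * Real.sin θ + y * Real.cos θ
  Real.exp (-(x' ^ 2 + γ ^ 2 * y' ^ 2) / (2 * σ ^ 2)) *
    Real.cos (2 * Real.pi * x' / lam + ψ)

/-- Coordinate of a `Fin 3` index in `{-1, 0, 1}`. -/
def coord (i : Fin 3) : ℝ := (i : ℝ) - 1

/-- The 3×3 Gabor kernel with parameters `(θ, σ, γ, λ, ψ)` (the Gabor generator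
function). -/
noncomputable def gaborKernel (θ σ γ lam ψ : ℝ) : Matrix (Fin 3) (Fin 3) ℝ :=
  fun x y => gabor θ σ γ lam ψ (coord x) (coord y)

/-- The pairing of a matrix with a Gabor kernel. -/
noncomputable def gaborPair (I : Matrix (Fin 3) (Fin 3) ℝ) (θ σ γ lam ψ : ℝ) : ℝ :=
  ∑ x : Fin 3, ∑ y : Fin 3, I x y * gaborKernel θ σ γ lam ψ x y

theorem coord_zero : coord 0 = -1 := by simp [coord]
theorem coord_one : coord 1 = 0 := by simp [coord]
theorem coord_two : coord 2 = 1 := by simp [coord]; norm_num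

theorem gabor_zero_angle (γ lam ψ x y : ℝ) : gabor 0 1 γ lam ψ x y =
    Real.exp (-(x ^ 2 + γ ^ 2 * y ^ 2) / 2) * Real.cos (2 * Real.pi * x / lam + ψ) := by
  simp [gabor]

theorem gabor_right_angle (γ lam ψ x y : ℝ) : gabor (Real.pi / 2) 1 γ lam ψ x y =
    Real.exp (-(y ^ 2 + γ ^ 2 * x ^ 2) / 2) * Real.cos (2 * Real.pi * y / lam + ψ) := by
  simp [gabor]

theorem gabor_diag (x y : ℝ) : gabor (Real.pi / 4) 1 1 (2 * √2) 0 x y =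
    Real.exp (-(x ^ 2 + y ^ 2) / 2) * Real.cos (Real.pi * (x + y) / 2) := by
  have h2 : √2 ^ 2 = (2 : ℝ) := Real.sq_sqrt (by norm_num)
  have h0 : √2 ≠ 0 := by positivity
  simp only [gabor, Real.cos_pi_div_four, Real.sin_pi_div_four]
  congr 2
  · ring_nf; rw [h2]; ring
  · field_simp; ring

/-- The nine parameter vectors `(θ, σ, γ, λ, ψ)`; all have `σ ≠ 0` and `λ ≠ 0`. -/
noncomputable def gaborParams : Fin 9 → Fin 5 → ℝ :=
  ![![0, 1, 0, 4, 0], ![0, 1, 1, 4, 0],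
    ![0, 1, 0, 2, 0], ![0, 1, 1, 2, 0],
    ![0, 1, 0, 4, -(Real.pi / 2)], ![0, 1, 1, 4, -(Real.pi / 2)],
    ![Real.pi / 2, 1, 0, 4, -(Real.pi / 2)], ![Real.pi / 2, 1, 1, 4, -(Real.pi / 2)],
    ![Real.pi / 4, 1, 1, 2 * √2, 0]]

theorem trig_vals : Real.cos (2 * Real.pi * (-1) / 4) = 0 ∧ Real.cos (2 * Real.pi * 1 / 4) = 0 ∧
    Real.cos (2 * Real.pi * (-1) / 2) = -1 ∧ Real.cos (2 * Real.pi * 1 / 2) = -1 ∧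
    Real.cos (2 * Real.pi * (-1) / 4 + -(Real.pi / 2)) = -1 ∧
    Real.cos (2 * Real.pi * 0 / 4 + -(Real.pi / 2)) = 0 ∧
    Real.cos (2 * Real.pi * 1 / 4 + -(Real.pi / 2)) = 1 ∧
    Real.cos (Real.pi * (-1 + -1) / 2) = -1 ∧ Real.cos (Real.pi * (1 + 1) / 2) = -1 ∧
    Real.cos (Real.pi * -1 / 2) = 0 ∧ Real.cos (Real.pi * (0 + -1) / 2) = 0 ∧
    Real.cos (Real.pi * 1 / 2) = 0 ∧ Real.cos (Real.pi * (0 + 1) / 2) = 0 := by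
  refine ⟨?_, ?_, ?_, ?_, ?_, ?_, ?_, ?_, ?_, ?_, ?_, ?_, ?_⟩
  · rw [show 2 * Real.pi * (-1) / 4 = -(Real.pi / 2) by ring]; simp
  · rw [show 2 * Real.pi * 1 / 4 = Real.pi / 2 by ring]; simp
  · rw [show 2 * Real.pi * (-1) / 2 = -Real.pi by ring]; simp
  · rw [show 2 * Real.pi * 1 / 2 = Real.pi by ring]; simp
  · rw [show 2 * Real.pi * (-1) / 4 + -(Real.pi / 2) = -Real.pi by ring]; simp
  · simp
  · rw [show 2 * Real.pi * 1 / 4 + -(Real.pi / 2) = 0 by ring]; simp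
  · rw [show Real.pi * (-1 + -1) / 2 = -Real.pi by ring]; simp
  · rw [show Real.pi * (1 + 1) / 2 = Real.pi by ring]; simp
  · rw [show Real.pi * -1 / 2 = -(Real.pi / 2) by ring]; simp
  · rw [show Real.pi * (0 + -1) / 2 = -(Real.pi / 2) by ring]; simp
  · rw [show Real.pi * 1 / 2 = Real.pi / 2 by ring]; simp
  · rw [show Real.pi * (0 + 1) / 2 = Real.pi / 2 by ring]; simp

theorem gaborParams_span (I : Matrix (Fin 3) (Fin 3) ℝ)
    (h : ∀ k : Fin 9, gaborPair I (gaborParams k 0) (gaborParams k 1) (gaborParams k 2)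
      (gaborParams k 3) (gaborParams k 4) = 0) : I = 0 := by
  obtain ⟨t1, t2, t3, t4, t5, t6, t7, t8, t9, t10, t11, t12, t13⟩ := trig_vals
  have e0 : Real.exp (-(1 / 2)) ≠ 0 := (Real.exp_pos _).ne'
  have e1 : Real.exp (-(1 / 2)) ≠ 1 := by
    rw [Ne, Real.exp_eq_one_iff]; norm_num
  have e2 : Real.exp (-1) = Real.exp (-(1 / 2)) * Real.exp (-(1 / 2)) := by
    rw [← Real.exp_add]; norm_num
  have h0 := h 0
  have h1 := h 1
  have h2 := h 2
  have h3 := h 3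
  have h4 := h 4
  have h5 := h 5
  have h6 := h 6
  have h7 := h 7
  have h8 := h 8
  clear h
  simp only [gaborParams, gaborPair, gaborKernel, Fin.sum_univ_three, Matrix.cons_val, coord_zero,
    coord_one, coord_two, gabor_zero_angle, gabor_right_angle, gabor_diag, add_zero,
    t1, t2, t3, t4, t5, t6, t7, t8, t9, t10, t11, t12, t13] at h0 h1 h2 h3 h4 h5 h6 h7 h8
  norm_num [e2] at h0 h1 h2 h3 h4 h5 h6 h7 h8
  generalize Real.exp (-(1 / 2)) = e at *
  have e1' : 1 - e ≠ 0 := sub_ne_zero.mpr (Ne.symm e1)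
  have cancel : ∀ a : ℝ, e * a = 0 → a = 0 := fun a ha => (mul_eq_zero.mp ha).resolve_left e0
  have cancel' : ∀ a : ℝ, (1 - e) * a = 0 → a = 0 :=
    fun a ha => (mul_eq_zero.mp ha).resolve_left e1'
  have a1 := cancel' (I 1 0 + I 1 2) (by linear_combination h0 - h1)
  have a2 := cancel (I 0 0 + I 0 1 + I 0 2 + (I 2 0 + I 2 1 + I 2 2)) (by linear_combination h0 - h2)
  have a3 := cancel (-(I 0 0 + I 0 1 + I 0 2) + (I 2 0 + I 2 1 + I 2 2)) (by linear_combination h4)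
  have a4 := cancel (I 0 0 * e + I 0 1 + I 0 2 * e + (I 2 0 * e + I 2 1 + I 2 2 * e))
    (by linear_combination h1 - h3)
  have a5 := cancel (-(I 0 0 * e + I 0 1 + I 0 2 * e) + (I 2 0 * e + I 2 1 + I 2 2 * e))
    (by linear_combination h5)
  have b0 := cancel' (I 0 0 + I 0 2) (by linear_combination (a2 - a3 - a4 + a5) / 2)
  have b2 := cancel' (I 2 0 + I 2 2) (by linear_combination (a2 + a3 - a4 - a5) / 2)
  have a6 := cancel (-I 0 0 + I 0 2 + (-I 1 0 + I 1 2) + (-I 2 0 + I 2 2))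
    (by linear_combination h6)
  have a7 := cancel (e * (-I 0 0 + I 0 2) + (-I 1 0 + I 1 2) + e * (-I 2 0 + I 2 2))
    (by linear_combination h7)
  have b1 := cancel' (-I 0 0 + I 0 2 + (-I 2 0 + I 2 2)) (by linear_combination a6 - a7)
  have c11 : I 1 1 = 0 := by linarith
  have a8 := cancel _ (cancel (e * (-I 0 0 + I 0 2 + I 2 0 - I 2 2)) (by linear_combination h8 - c11))
  ext i j
  fin_cases i <;> fin_cases j <;> simp <;> linarith

theorem generator_cast (T : ℕ) (n : Fin T → ℕ)
    (f : (t : Fin T) → (Fin (n t) → ℝ) → Matrix (Fin 3) (Fin 3) ℝ)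
    (tstar : Fin T) (hn : n tstar = 5)
    (hgabor : ∀ v : Fin (n tstar) → ℝ,
      f tstar v =
        gaborKernel (v (Fin.cast hn.symm 0)) (v (Fin.cast hn.symm 1)) (v (Fin.cast hn.symm 2))
          (v (Fin.cast hn.symm 3)) (v (Fin.cast hn.symm 4)))
    (s : Fin T) (hs : s = tstar) (hs5 : n s = 5) (p : Fin 5 → ℝ) :
    f s (fun i => p (Fin.cast hs5 i)) = gaborKernel (p 0) (p 1) (p 2) (p 3) (p 4) := by
  subst hs
  rw [hgabor]
  rfl

/-- **Corollary 3.** Let `f₁, …, f_T` be generator functions (with parameter dimensions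
`n t`), one of which, `f_{t*}`, is the Gabor generator. Then there is `n* ∈ ℕ` such
that for any number `od` of first-layer kernels and any assignment `t` of a generator
to each kernel, if at least `n*` kernels use the Gabor generator, then parameters can
be chosen making the only 3×3 matrix orthogonal to all the generated kernels the zero
matrix — i.e. the corresponding GO-CNN is well defined. -/
theorem goCNN_wellDefined_of_enough_gabor_kernels
    (T : ℕ) (n : Fin T → ℕ)
    (f : (t : Fin T) → (Fin (n t) → ℝ) → Matrix (Fin 3) (Fin 3) ℝ)
    (tstar : Fin T) (hn : n tstar = 5)
    (hgabor : ∀ v : Fin (n tstar) → ℝ,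
      f tstar v =
        gaborKernel (v ⟨0, by omega⟩) (v ⟨1, by omega⟩) (v ⟨2, by omega⟩)
          (v ⟨3, by omega⟩) (v ⟨4, by omega⟩)) :
    ∃ nstar : ℕ, ∀ (od : ℕ) (t : Fin od → Fin T),
      nstar ≤ (Finset.univ.filter fun j : Fin od => t j = tstar).card →
      ∃ prm : (j : Fin od) → (Fin (n (t j)) → ℝ),
        ∀ I : Matrix (Fin 3) (Fin 3) ℝ,
          (∀ j : Fin od,
            ∑ x : Fin 3, ∑ y : Fin 3, I x y * f (t j) (prm j) x y = 0) →
          I = 0 := by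
  refine ⟨9, fun od t hcard => ?_⟩
  obtain ⟨e⟩ : Nonempty (Fin 9 ↪ {j // j ∈ Finset.univ.filter fun j : Fin od => t j = tstar}) := by
    apply Function.Embedding.nonempty_of_card_le
    rw [Fintype.card_fin, Fintype.card_coe]
    exact hcard
  have he : ∀ k, t (e k).1 = tstar := fun k => (Finset.mem_filter.mp (e k).2).2
  let q : Fin od → Fin 9 := Function.invFun (fun k => (e k).1)
  have hq : ∀ k, q (e k).1 = k :=
    Function.leftInverse_invFun (fun a b hab => e.injective (Subtype.ext hab))
  refine ⟨fun j => if h : n (t j) = 5 then fun i => gaborParams (q j) (Fin.cast h i) else 0,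
    fun I hI => gaborParams_span I fun k => ?_⟩
  have h5 : n (t (e k).1) = 5 := by rw [he k, hn]
  have := hI (e k).1
  simp only [h5, dif_pos] at this
  rw [generator_cast T n f tstar hn hgabor _ (he k) h5 (gaborParams (q (e k).1)), hq] at this
  exact this
end

section
/- Let b₀, b₁, b₂, b₃ ∈ ℝ. If b₀ + b₁·exp(−(1+γ²)/(2σ²)) + b₂·exp(−1/(2σ²)) + b₃·exp(−γ²/(2σ²)) = 0 for every γ ∈ ℝ and every σ > 0, then b₀ = b₁ = b₂ = b₃ = 0. (Linear independence claim, equations (14.6)–(14.9) in the proof of Proposition 2.) -/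
/-- **Linear independence claim (equations (14.6)–(14.9) in the proof of Proposition 2).**
If `b₀ + b₁·exp(−(1+γ²)/(2σ²)) + b₂·exp(−1/(2σ²)) + b₃·exp(−γ²/(2σ²)) = 0` for every
`γ ∈ ℝ` and every `σ > 0`, then `b₀ = b₁ = b₂ = b₃ = 0`. -/
theorem gabor_exponentials_linear_independent (b₀ b₁ b₂ b₃ : ℝ)
    (h : ∀ (γ σ : ℝ), 0 < σ →
      b₀ + b₁ * Real.exp (-(1 + γ ^ 2) / (2 * σ ^ 2)) +
        b₂ * Real.exp (-1 / (2 * σ ^ 2)) + b₃ * Real.exp (-γ ^ 2 / (2 * σ ^ 2)) = 0) :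
    b₀ = 0 ∧ b₁ = 0 ∧ b₂ = 0 ∧ b₃ = 0 := by
  have key : ∀ σ : ℝ, 0 < σ → b₁ * Real.exp (-1 / (2 * σ ^ 2)) + b₃ = 0 ∧
      b₀ + b₂ * Real.exp (-1 / (2 * σ ^ 2)) = 0 := by
    intro σ hσ
    have h0 := h 0 σ hσ
    have h1 := h 1 σ hσ
    have e : Real.exp (-(1 + 1 ^ 2) / (2 * σ ^ 2)) =
        Real.exp (-1 / (2 * σ ^ 2)) * Real.exp (-1 / (2 * σ ^ 2)) := by
      rw [← Real.exp_add]; congr 1; ring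
    rw [e] at h1
    have e0 : (-(1 + (0:ℝ) ^ 2) / (2 * σ ^ 2)) = -1 / (2 * σ ^ 2) := by ring
    have e1 : (-(0:ℝ) ^ 2 / (2 * σ ^ 2)) = 0 := by ring
    have e2 : (-(1:ℝ) ^ 2 / (2 * σ ^ 2)) = -1 / (2 * σ ^ 2) := by ring
    rw [e0, e1, Real.exp_zero] at h0
    rw [e2] at h1
    have hx : Real.exp (-1 / (2 * σ ^ 2)) < 1 := by
      rw [Real.exp_lt_one_iff]
      exact div_neg_of_neg_of_pos (by norm_num) (by positivity)
    generalize Real.exp (-1 / (2 * σ ^ 2)) = x at *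
    have hz : (b₁ * x + b₃) * (1 - x) = 0 := by linear_combination h0 - h1
    have hw : b₁ * x + b₃ = 0 :=
      (mul_eq_zero.mp hz).resolve_right (by linarith)
    exact ⟨hw, by linear_combination h0 - hw⟩
  obtain ⟨p1, p2⟩ := key 1 one_pos
  obtain ⟨q1, q2⟩ := key (1 / 2) (by norm_num)
  have hne : Real.exp (-1 / (2 * (1:ℝ) ^ 2)) - Real.exp (-1 / (2 * (1 / 2 : ℝ) ^ 2)) ≠ 0 := by
    rw [sub_ne_zero]
    intro hh
    have := Real.exp_injective hh
    norm_num at this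
  generalize Real.exp (-1 / (2 * (1:ℝ) ^ 2)) = x at *
  generalize Real.exp (-1 / (2 * (1 / 2 : ℝ) ^ 2)) = y at *
  have z1 : b₁ = 0 := by
    have : b₁ * (x - y) = 0 := by linear_combination p1 - q1
    exact (mul_eq_zero.mp this).resolve_right hne
  have z2 : b₂ = 0 := by
    have : b₂ * (x - y) = 0 := by linear_combination p2 - q2
    exact (mul_eq_zero.mp this).resolve_right hne
  subst z1 z2
  exact ⟨by linarith, rfl, rfl, by linarith⟩
end

section
/- Let a be a real 3×3 matrix indexed by (x, y) ∈ {−1, 0, 1}². If Σ_{x ∈ {−1,0,1}} Σ_{y ∈ {−1,0,1}} a_{x,y} · exp(−(x² + γ²y²)/(2σ²)) = 0 for every γ ∈ ℝ and every σ > 0, then the four corner entries sum to zero (a_{−1,−1} + a_{−1,1} + a_{1,−1} + a_{1,1} = 0), the two entries with y = 0 and x = ±1 sum to zero (a_{−1,0} + a_{1,0} = 0), the two entries with x = 0 and y = ±1 sum to zero (a_{0,−1} + a_{0,1} = 0), and the center entry is zero (a_{0,0} = 0). (Equation (14.10), Situation I in the proof of Proposition 2: the Gabor kernel with θ = 0,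 λ = 1, ψ = 0.) -/
/-- **Equation (14.10), Situation I in the proof of Proposition 2.** If a 3×3 matrix `a`,
indexed by `(x, y) ∈ {-1,0,1}²` (via `coord`), satisfies
`∑_{x,y} a_{x,y}·exp(−(x² + γ²y²)/(2σ²)) = 0` for every `γ ∈ ℝ` and every `σ > 0`, then
the four corner entries sum to zero, the two entries with `y = 0, x = ±1` sum to zero,
the two entries with `x = 0, y = ±1` sum to zero, and the center entry is `0`. -/
theorem situation_one_constraints (a : Matrix (Fin 3) (Fin 3) ℝ)
    (h : ∀ (γ σ : ℝ), 0 < σ →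
      ∑ x : Fin 3, ∑ y : Fin 3,
        a x y * Real.exp (-((coord x) ^ 2 + γ ^ 2 * (coord y) ^ 2) / (2 * σ ^ 2)) = 0) :
    a 0 0 + a 0 2 + a 2 0 + a 2 2 = 0 ∧
    a 0 1 + a 2 1 = 0 ∧
    a 1 0 + a 1 2 = 0 ∧
    a 1 1 = 0 := by
  have key : ∀ (γ σ : ℝ), 0 < σ →
      a 1 1 + (a 0 1 + a 2 1) * Real.exp (-1 / (2 * σ ^ 2))
        + (a 1 0 + a 1 2) * Real.exp (-γ ^ 2 / (2 * σ ^ 2))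
        + (a 0 0 + a 0 2 + a 2 0 + a 2 2) *
          Real.exp (-(1 + γ ^ 2) / (2 * σ ^ 2)) = 0 := by
    intro γ σ hσ
    have c0 : coord 0 ^ 2 = 1 := by norm_num [coord]
    have c1 : coord 1 ^ 2 = 0 := by norm_num [coord]
    have c2 : coord 2 ^ 2 = 1 := by norm_num [coord]
    have := h γ σ hσ
    simp only [Fin.sum_univ_three, c0, c1, c2, mul_one, mul_zero, add_zero, zero_add,
      neg_zero, zero_div, Real.exp_zero] at this
    linarith
  have step : ∀ σ : ℝ, 0 < σ →
      a 1 1 + (a 0 1 + a 2 1) * Real.exp (-1 / (2 * σ ^ 2)) = 0 ∧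
      (a 1 0 + a 1 2) + (a 0 0 + a 0 2 + a 2 0 + a 2 2) *
        Real.exp (-1 / (2 * σ ^ 2)) = 0 := by
    intro σ hσ
    have h0 := key 0 σ hσ
    have h1 := key 1 σ hσ
    have e0 : Real.exp (-(0:ℝ) ^ 2 / (2 * σ ^ 2)) = 1 := by simp
    have e1 : -(1 + (0:ℝ) ^ 2) / (2 * σ ^ 2) = -1 / (2 * σ ^ 2) := by norm_num
    have e2 : -(1:ℝ) ^ 2 / (2 * σ ^ 2) = -1 / (2 * σ ^ 2) := by norm_num
    have e3 : -(1 + (1:ℝ) ^ 2) / (2 * σ ^ 2) = -1 / (2 * σ ^ 2) + -1 / (2 * σ ^ 2) := by ring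
    rw [e0, e1] at h0
    rw [e2, e3, Real.exp_add] at h1
    have hu : Real.exp (-1 / (2 * σ ^ 2)) < 1 := by
      rw [← Real.exp_zero, Real.exp_lt_exp]
      exact div_neg_of_neg_of_pos (by norm_num) (by positivity)
    set u := Real.exp (-1 / (2 * σ ^ 2))
    have hz : (1 - u) * ((a 1 0 + a 1 2) + (a 0 0 + a 0 2 + a 2 0 + a 2 2) * u) = 0 := by
      linear_combination h0 - h1
    have hz' := (mul_eq_zero.mp hz).resolve_left (by linarith)
    exact ⟨by linear_combination h0 - hz', hz'⟩
  obtain ⟨p1, p2⟩ := step 1 one_pos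
  obtain ⟨q1, q2⟩ := step 2 two_pos
  have hlt : Real.exp (-1 / (2 * (1:ℝ) ^ 2)) < Real.exp (-1 / (2 * (2:ℝ) ^ 2)) :=
    Real.exp_lt_exp.mpr (by norm_num)
  set u := Real.exp (-1 / (2 * (1:ℝ) ^ 2))
  set w := Real.exp (-1 / (2 * (2:ℝ) ^ 2))
  have hne : w - u ≠ 0 := (sub_pos.mpr hlt).ne'
  have hR : a 0 1 + a 2 1 = 0 :=
    (mul_eq_zero.mp (show (w - u) * (a 0 1 + a 2 1) = 0 by
      linear_combination q1 - p1)).resolve_left hne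
  have hK : a 0 0 + a 0 2 + a 2 0 + a 2 2 = 0 :=
    (mul_eq_zero.mp (show (w - u) * (a 0 0 + a 0 2 + a 2 0 + a 2 2) = 0 by
      linear_combination q2 - p2)).resolve_left hne
  exact ⟨hK, hR, by linear_combination p2 - u * hK, by linear_combination p1 - u * hR⟩
end
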